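/- arXiv:2410.13578 — 3 statements merged into one kernel-verified Lean document; each statement's English description precedes it below -/
import Mathlib

section
/- Let q be a prime power and let n, k be positive integers with 0 < k < n. The number of distinct symplectic LCD [2n,2k]_q codes equals q^{2k(n−k)} · [n choose k]_{q²}, where [n choose k]_{q²} = ∏_{i=0}^{k−1} (q^{2(n−i)} − 1)/(q^{2(k−i)} − 1) is the Gaussian binomial coefficient with base q². -/
open scoped BigOperators
open Matrix

noncomputable section

/-- The symplectic inner product `⟨x,y⟩_s = ∑_{i=1}^n (x_i y_{n+i} - x_{n+i} y_i)` on `K^{2n}`. -/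
def sympInner {K : Type*} [Field K] (n : ℕ) (x y : Fin (2 * n) → K) : K :=
  ∑ i : Fin n,
    (x ⟨i.1, by have := i.2; omega⟩ * y ⟨n + i.1, by have := i.2; omega⟩ -
      x ⟨n + i.1, by have := i.2; omega⟩ * y ⟨i.1, by have := i.2; omega⟩)

/-- The symplectic dual `C^{⊥s}` of a code `C ⊆ K^{2n}`. -/
def sympDual {K : Type*} [Field K] (n : ℕ) (C : Submodule K (Fin (2 * n) → K)) :
    Submodule K (Fin (2 * n) → K) where
  carrier := {y | ∀ x ∈ C, sympInner n x y = 0}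
  zero_mem' := by
    intro x hx
    simp [sympInner]
  add_mem' := by
    intro y z hy hz x hx
    have h1 := hy x hx
    have h2 := hz x hx
    simp only [sympInner, Pi.add_apply] at h1 h2 ⊢
    calc (∑ i : Fin n, _) = (∑ i : Fin n,
          (x ⟨i.1, by have := i.2; omega⟩ * y ⟨n + i.1, by have := i.2; omega⟩ -
            x ⟨n + i.1, by have := i.2; omega⟩ * y ⟨i.1, by have := i.2; omega⟩)) +
        ∑ i : Fin n,
          (x ⟨i.1, by have := i.2; omega⟩ * z ⟨n + i.1, by have := i.2; omega⟩ -
            x ⟨n + i.1, by have := i.2; omega⟩ * z ⟨i.1, by have := i.2; omega⟩) := by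
          rw [← Finset.sum_add_distrib]
          exact Finset.sum_congr rfl fun i _ => by ring
      _ = 0 := by rw [h1, h2, add_zero]
  smul_mem' := by
    intro c y hy x hx
    have h := hy x hx
    simp only [sympInner, Pi.smul_apply, smul_eq_mul] at h ⊢
    calc (∑ i : Fin n, _) = c * ∑ i : Fin n,
          (x ⟨i.1, by have := i.2; omega⟩ * y ⟨n + i.1, by have := i.2; omega⟩ -
            x ⟨n + i.1, by have := i.2; omega⟩ * y ⟨i.1, by have := i.2; omega⟩) := by
          rw [Finset.mul_sum]
          exact Finset.sum_congr rfl fun i _ => by ring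
      _ = 0 := by rw [h, mul_zero]

/-- The matrix `Ω_n = [[O, I_n], [-I_n, O]]` defining the symplectic inner product. -/
def sympOmega (n : ℕ) (K : Type*) [Field K] : Matrix (Fin (2 * n)) (Fin (2 * n)) K :=
  Matrix.of fun i j => if j.1 = i.1 + n then 1 else if i.1 = j.1 + n then -1 else 0

/-- The block diagonal matrix `diag(J₂, …, J₂)` (with `J₂ = [[0,1],[-1,0]]`) of size `N`. -/
def jayBlocks (N : ℕ) (K : Type*) [Field K] : Matrix (Fin N) (Fin N) K :=
  Matrix.of fun i j =>
    if i.1 % 2 = 0 ∧ j.1 = i.1 + 1 then 1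
    else if j.1 % 2 = 0 ∧ i.1 = j.1 + 1 then -1 else 0

section helpers

variable {K V : Type*} [Field K] [AddCommGroup V] [Module K V]

def SND (B : V →ₗ[K] V →ₗ[K] K) (W : Submodule K V) : Prop :=
  ∀ y ∈ W, (∀ x ∈ W, B x y = 0) → y = 0

def STup (B : V →ₗ[K] V →ₗ[K] K) (k : ℕ) (W : Submodule K V) (t : Fin k → V × V) : Prop :=
  (∀ i, (t i).1 ∈ W ∧ (t i).2 ∈ W ∧ B (t i).1 (t i).2 = 1) ∧
  (∀ i j, i ≠ j → B (t i).1 (t j).1 = 0 ∧ B (t i).2 (t j).2 = 0 ∧ B (t i).1 (t j).2 = 0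
    ∧ B (t i).2 (t j).1 = 0)

def SPerp (B : V →ₗ[K] V →ₗ[K] K) (W : Submodule K V) (p : V × V) : Submodule K V :=
  W ⊓ LinearMap.ker (B p.1) ⊓ LinearMap.ker (B p.2)

lemma mem_SPerp (B : V →ₗ[K] V →ₗ[K] K) (W : Submodule K V) (p : V × V) (x : V) :
    x ∈ SPerp B W p ↔ x ∈ W ∧ B p.1 x = 0 ∧ B p.2 x = 0 := by
  simp [SPerp, and_assoc]

lemma alt_neg {B : V →ₗ[K] V →ₗ[K] K} (hB : ∀ x, B x x = 0) (x y : V) : B x y = - B y x := by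
  have h := hB (x + y)
  simp [hB] at h
  linear_combination h

lemma SPerp_nd {B : V →ₗ[K] V →ₗ[K] K} (hB : ∀ x, B x x = 0) {W : Submodule K V}
    (hW : SND B W) {p : V × V} (h1 : p.1 ∈ W) (h2 : p.2 ∈ W) (h : B p.1 p.2 = 1) :
    SND B (SPerp B W p) := by
  intro y hy hy'
  rw [mem_SPerp] at hy
  apply hW y hy.1
  intro x hx
  have h21 : B p.2 p.1 = -1 := by rw [alt_neg hB, h]
  have hm : x + B p.2 x • p.1 - B p.1 x • p.2 ∈ SPerp B W p := by
    rw [mem_SPerp]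
    refine ⟨W.sub_mem (W.add_mem hx (W.smul_mem _ h1)) (W.smul_mem _ h2), ?_, ?_⟩
    · simp [hB, h]
    · simp [hB, h21]
  have := hy' _ hm
  simpa [hy.2.1, hy.2.2] using this

lemma SPerp_finrank [FiniteDimensional K V]
    {B : V →ₗ[K] V →ₗ[K] K} (hB : ∀ x, B x x = 0) {W : Submodule K V}
    {p : V × V} (h1 : p.1 ∈ W) (h2 : p.2 ∈ W) (h : B p.1 p.2 = 1) :
    Module.finrank K (SPerp B W p) + 2 = Module.finrank K W := by
  have h21 : B p.2 p.1 = -1 := by rw [alt_neg hB, h]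
  let φ : W →ₗ[K] K × K := ((B p.1).prod (B p.2)).comp W.subtype
  have hs : LinearMap.range φ = ⊤ := by
    rw [LinearMap.range_eq_top]
    rintro ⟨a, b⟩
    refine ⟨⟨a • p.2 - b • p.1, W.sub_mem (W.smul_mem _ h2) (W.smul_mem _ h1)⟩, ?_⟩
    simp [φ, hB, h, h21]
  have hk : (LinearMap.ker φ).map W.subtype = SPerp B W p := by
    ext x
    rw [mem_SPerp]
    simp [φ]
    tauto
  have h3 := LinearMap.finrank_range_add_finrank_ker φ
  have h4 : Module.finrank K ((LinearMap.ker φ).map W.subtype) = Module.finrank K (LinearMap.ker φ) :=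
    Submodule.finrank_map_subtype_eq _ _
  rw [hs, finrank_top] at h3
  rw [← hk, h4]
  simp at h3
  omega

lemma card_second [FiniteDimensional K V] [Fintype K]
    {B : V →ₗ[K] V →ₗ[K] K} (hB : ∀ x, B x x = 0) {W : Submodule K V}
    (hW : SND B W) {e : V} (he : e ∈ W) (he0 : e ≠ 0) :
    Nat.card {f : V // f ∈ W ∧ B e f = 1} = Fintype.card K ^ (Module.finrank K W - 1) := by
  let φ : W →ₗ[K] K := (B e).comp W.subtype
  have hne : φ ≠ 0 := by
    intro h0
    apply he0
    apply hW e he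
    intro x hx
    rw [alt_neg hB]
    have := LinearMap.congr_fun h0 ⟨x, hx⟩
    simpa [φ] using this
  have hsurj : Function.Surjective φ := LinearMap.surjective hne
  obtain ⟨f0, hf0⟩ := hsurj 1
  have h3 := LinearMap.finrank_range_add_finrank_ker φ
  rw [LinearMap.range_eq_top.2 hsurj, finrank_top, Module.finrank_self] at h3
  have hf0' : B e f0 = 1 := hf0
  have e1 : {f : V // f ∈ W ∧ B e f = 1} ≃ LinearMap.ker φ :=
    { toFun := fun f => ⟨⟨f.1, f.2.1⟩ - f0, by
        have := f.2.2
        rw [LinearMap.mem_ker, map_sub, hf0]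
        simp [φ, this]⟩
      invFun := fun g => ⟨(g.1 + f0 : W), (g.1 + f0).2, by
        have : φ g.1 = 0 := g.2
        have h' : B e g.1 = 0 := this
        simp [hf0', h']⟩
      left_inv := fun f => by simp
      right_inv := fun g => by
        apply Subtype.ext
        apply Subtype.ext
        simp }
  rw [Nat.card_congr e1, Module.natCard_eq_pow_finrank (K := K), Nat.card_eq_fintype_card]
  congr 1
  omega

lemma card_pairs [FiniteDimensional K V] [Fintype K]
    {B : V →ₗ[K] V →ₗ[K] K} (hB : ∀ x, B x x = 0) {W : Submodule K V}
    (hW : SND B W) :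
    Nat.card {p : V × V // p.1 ∈ W ∧ p.2 ∈ W ∧ B p.1 p.2 = 1} =
      (Fintype.card K ^ (Module.finrank K W) - 1) *
        Fintype.card K ^ (Module.finrank K W - 1) := by
  classical
  haveI : Finite V := Module.finite_of_finite K
  have e1 : {p : V × V // p.1 ∈ W ∧ p.2 ∈ W ∧ B p.1 p.2 = 1} ≃
      Σ e : {e : V // e ∈ W ∧ e ≠ 0}, {f : V // f ∈ W ∧ B e.1 f = 1} :=
    { toFun := fun p => ⟨⟨p.1.1, p.2.1, by
        intro h0
        have := p.2.2.2
        simp [h0] at this⟩, ⟨p.1.2, p.2.2⟩⟩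
      invFun := fun s => ⟨(s.1.1, s.2.1), s.1.2.1, s.2.2⟩
      left_inv := fun p => rfl
      right_inv := fun s => rfl }
  have e2 : {e : V // e ∈ W ∧ e ≠ 0} ≃ {w : W // w ≠ 0} :=
    { toFun := fun e => ⟨⟨e.1, e.2.1⟩, fun h0 => e.2.2 (congrArg Subtype.val h0)⟩
      invFun := fun w => ⟨w.1.1, w.1.2, fun h0 => w.2 (Subtype.ext h0)⟩
      left_inv := fun p => rfl
      right_inv := fun s => rfl }
  haveI := Fintype.ofFinite W
  haveI := Fintype.ofFinite {e : V // e ∈ W ∧ e ≠ 0}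
  have h2 : Nat.card {e : V // e ∈ W ∧ e ≠ 0} = Fintype.card K ^ (Module.finrank K W) - 1 := by
    rw [Nat.card_congr e2, ← Nat.card_eq_fintype_card (α := K), ← Module.natCard_eq_pow_finrank,
      Nat.card_eq_fintype_card, Nat.card_eq_fintype_card, Fintype.card_subtype_compl,
      Fintype.card_subtype_eq]
  rw [Nat.card_congr e1, Nat.card_sigma,
    Finset.sum_congr rfl (fun e _ => card_second hB hW e.2.1 e.2.2), Finset.sum_const,
    Finset.card_univ, ← Nat.card_eq_fintype_card, h2, smul_eq_mul]

def consEquiv {B : V →ₗ[K] V →ₗ[K] K} (hB : ∀ x, B x x = 0) (W : Submodule K V) (k : ℕ) :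
    {t : Fin (k+1) → V × V // STup B (k+1) W t} ≃
      Σ p : {p : V × V // p.1 ∈ W ∧ p.2 ∈ W ∧ B p.1 p.2 = 1},
        {t : Fin k → V × V // STup B k (SPerp B W p.1) t} where
  toFun t := ⟨⟨t.1 0, t.2.1 0⟩, ⟨fun i => t.1 i.succ, by
    obtain ⟨t, h1, h2⟩ := t
    refine ⟨fun i => ?_, fun i j hij => h2 _ _ (by simpa using hij)⟩
    have := h2 0 i.succ (Fin.succ_ne_zero i).symm
    have h3 := h1 i.succ
    simp only [mem_SPerp]
    tauto⟩⟩
  invFun s := ⟨Fin.cons s.1.1 s.2.1, by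
    obtain ⟨⟨p, hp⟩, ⟨t, h1, h2⟩⟩ := s
    simp only [mem_SPerp] at h1
    refine ⟨fun i => ?_, fun i j hij => ?_⟩
    · refine Fin.cases ?_ (fun i => ?_) i
      · simpa using hp
      · have := h1 i
        simp only [Fin.cons_succ]
        tauto
    · revert hij
      refine Fin.cases ?_ (fun i => ?_) i <;> refine Fin.cases ?_ (fun j => ?_) j
      · simp
      · intro _
        have := h1 j
        simp only [Fin.cons_succ, Fin.cons_zero]
        tauto
      · intro _
        have := h1 i
        simp only [Fin.cons_succ, Fin.cons_zero]
        rw [alt_neg hB _ p.1, alt_neg hB _ p.2, alt_neg hB _ p.2, alt_neg hB _ p.1]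
        simp only [neg_eq_zero]
        tauto
      · intro hij
        simp only [Fin.cons_succ]
        exact h2 i j (by simpa using hij)⟩
  left_inv t := by
    apply Subtype.ext
    exact Fin.cons_self_tail t.1
  right_inv s := by
    obtain ⟨⟨p, hp⟩, ⟨t, h1, h2⟩⟩ := s
    rfl

def SCnt (q m k : ℕ) : ℕ := ∏ i ∈ Finset.range k, (q ^ (2 * (m - i)) - 1) * q ^ (2 * (m - i) - 1)

lemma card_STup [FiniteDimensional K V] [Fintype K]
    {B : V →ₗ[K] V →ₗ[K] K} (hB : ∀ x, B x x = 0) (k : ℕ) : ∀ (m : ℕ) (W : Submodule K V)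
    (_ : SND B W) (_ : Module.finrank K W = 2 * m),
    Nat.card {t : Fin k → V × V // STup B k W t} = SCnt (Fintype.card K) m k := by
  classical
  haveI : Finite V := Module.finite_of_finite K
  induction k with
  | zero =>
    intro m W _ _
    have : Unique {t : Fin 0 → V × V // STup B 0 W t} :=
      { default := ⟨fun i => i.elim0, fun i => i.elim0, fun i => i.elim0⟩
        uniq := fun a => Subtype.ext (Subsingleton.elim _ _) }
    simp [SCnt]
  | succ k ih =>
    intro m W hW hm
    haveI := Fintype.ofFinite {p : V × V // p.1 ∈ W ∧ p.2 ∈ W ∧ B p.1 p.2 = 1}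
    rw [Nat.card_congr (consEquiv hB W k), Nat.card_sigma,
      Finset.sum_congr rfl (fun p _ => ih (m - 1) (SPerp B W p.1)
        (SPerp_nd hB hW p.2.1 p.2.2.1 p.2.2.2)
        (by have := SPerp_finrank hB p.2.1 p.2.2.1 p.2.2.2; omega)), Finset.sum_const,
      Finset.card_univ, ← Nat.card_eq_fintype_card, card_pairs hB hW, hm, smul_eq_mul]
    rw [SCnt, SCnt, Finset.prod_range_succ', mul_comm]
    congr 1
    refine Finset.prod_congr rfl fun i _ => ?_
    rw [Nat.sub_sub, add_comm 1 i]

def SFam {k : ℕ} (t : Fin k → V × V) : Fin k ⊕ Fin k → V :=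
  Sum.elim (fun i => (t i).1) (fun i => (t i).2)

lemma STup_comb {B : V →ₗ[K] V →ₗ[K] K} (hB : ∀ x, B x x = 0) {k : ℕ} {W : Submodule K V}
    {t : Fin k → V × V} (ht : STup B k W t) (c : Fin k ⊕ Fin k → K) (j : Fin k) :
    B (t j).1 (∑ i, c i • SFam t i) = c (Sum.inr j) ∧
    B (t j).2 (∑ i, c i • SFam t i) = - c (Sum.inl j) := by
  have h1 : ∀ i, B (t j).1 (t i).1 = 0 := fun i => by
    by_cases h : j = i
    · rw [h, hB]
    · exact (ht.2 j i h).1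
  have h2 : ∀ i, B (t j).2 (t i).2 = 0 := fun i => by
    by_cases h : j = i
    · rw [h, hB]
    · exact (ht.2 j i h).2.1
  have h3 : ∀ i, B (t j).1 (t i).2 = if j = i then 1 else 0 := fun i => by
    split_ifs with h
    · rw [h, (ht.1 i).2.2]
    · exact (ht.2 j i h).2.2.1
  have h4 : ∀ i, B (t j).2 (t i).1 = if j = i then -1 else 0 := fun i => by
    split_ifs with h
    · rw [h, alt_neg hB, (ht.1 i).2.2]
    · exact (ht.2 j i h).2.2.2
  simp [SFam, Fintype.sum_sum_type, h1, h2, h3, h4]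

lemma STup_li {B : V →ₗ[K] V →ₗ[K] K} (hB : ∀ x, B x x = 0) {k : ℕ} {W : Submodule K V}
    {t : Fin k → V × V} (ht : STup B k W t) : LinearIndependent K (SFam t) := by
  rw [Fintype.linearIndependent_iff]
  intro c hc i
  rcases i with j | j
  · have := (STup_comb hB ht c j).2
    rw [hc] at this
    simpa using this.symm
  · have := (STup_comb hB ht c j).1
    rw [hc] at this
    simpa using this.symm

def SSpan {k : ℕ} (t : Fin k → V × V) : Submodule K V := Submodule.span K (Set.range (SFam t))

lemma SSpan_finrank {B : V →ₗ[K] V →ₗ[K] K} (hB : ∀ x, B x x = 0) {k : ℕ} {W : Submodule K V}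
    {t : Fin k → V × V} (ht : STup B k W t) :
    Module.finrank K (SSpan t : Submodule K V) = 2 * k := by
  rw [SSpan, finrank_span_eq_card (STup_li hB ht)]
  simp [two_mul]

lemma mem_SSpan {k : ℕ} (t : Fin k → V × V) (j : Fin k) :
    (t j).1 ∈ (SSpan t : Submodule K V) ∧ (t j).2 ∈ (SSpan t : Submodule K V) :=
  ⟨Submodule.subset_span ⟨Sum.inl j, rfl⟩, Submodule.subset_span ⟨Sum.inr j, rfl⟩⟩

lemma SSpan_nd {B : V →ₗ[K] V →ₗ[K] K} (hB : ∀ x, B x x = 0) {k : ℕ} {W : Submodule K V}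
    {t : Fin k → V × V} (ht : STup B k W t) : SND B (SSpan t) := by
  intro y hy h
  obtain ⟨c, rfl⟩ := (Submodule.mem_span_range_iff_exists_fun K).1 hy
  have hc : c = 0 := by
    funext i
    rcases i with j | j
    · have := (STup_comb hB ht c j).2
      rw [h _ (mem_SSpan t j).2] at this
      simpa using this.symm
    · have := (STup_comb hB ht c j).1
      rw [h _ (mem_SSpan t j).1] at this
      simpa using this.symm
  simp [hc]

lemma SSpan_le {B : V →ₗ[K] V →ₗ[K] K} {k : ℕ} {W : Submodule K V}
    {t : Fin k → V × V} (ht : STup B k W t) : SSpan t ≤ W := by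
  rw [SSpan, Submodule.span_le]
  rintro _ ⟨i | i, rfl⟩
  · exact (ht.1 i).1
  · exact (ht.1 i).2.1

def fibEquiv [FiniteDimensional K V] {B : V →ₗ[K] V →ₗ[K] K} (hB : ∀ x, B x x = 0) (k : ℕ) :
    {t : Fin k → V × V // STup B k ⊤ t} ≃
      Σ C : {C : Submodule K V // Module.finrank K C = 2 * k ∧ SND B C},
        {t : Fin k → V × V // STup B k C.1 t} where
  toFun t := ⟨⟨SSpan t.1, SSpan_finrank hB t.2, SSpan_nd hB t.2⟩, ⟨t.1,
    fun i => ⟨(mem_SSpan t.1 i).1, (mem_SSpan t.1 i).2, (t.2.1 i).2.2⟩, t.2.2⟩⟩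
  invFun s := ⟨s.2.1, fun i => ⟨trivial, trivial, (s.2.2.1 i).2.2⟩, s.2.2.2⟩
  left_inv t := rfl
  right_inv s := by
    obtain ⟨⟨C, hC, hC'⟩, ⟨t, ht⟩⟩ := s
    have : SSpan t = C := Submodule.eq_of_le_of_finrank_eq (SSpan_le ht)
      (by rw [SSpan_finrank hB ht, hC])
    subst this
    rfl

lemma card_SND [FiniteDimensional K V] [Fintype K]
    {B : V →ₗ[K] V →ₗ[K] K} (hB : ∀ x, B x x = 0) (hV : SND B ⊤) (n k : ℕ)
    (hn : Module.finrank K V = 2 * n) :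
    Nat.card {C : Submodule K V // Module.finrank K C = 2 * k ∧ SND B C} *
      SCnt (Fintype.card K) k k = SCnt (Fintype.card K) n k := by
  classical
  haveI : Finite V := Module.finite_of_finite K
  haveI : Finite (Submodule K V) := Finite.of_injective (fun C => (C : Set V)) SetLike.coe_injective
  haveI := Fintype.ofFinite {C : Submodule K V // Module.finrank K C = 2 * k ∧ SND B C}
  rw [← card_STup hB k n ⊤ hV (by rw [finrank_top, hn]), Nat.card_congr (fibEquiv hB k),
    Nat.card_sigma,
    Finset.sum_congr rfl (fun C _ => card_STup hB k k C.1 C.2.2 C.2.1), Finset.sum_const,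
    Finset.card_univ, smul_eq_mul]
  congr 1
  exact Nat.card_eq_fintype_card

def sForm (K : Type*) [Field K] (n : ℕ) :
    (Fin (2 * n) → K) →ₗ[K] (Fin (2 * n) → K) →ₗ[K] K :=
  LinearMap.mk₂ K (sympInner n)
    (by intro x x' y
        simp only [sympInner, ← Finset.sum_add_distrib, Pi.add_apply]
        exact Finset.sum_congr rfl fun i _ => by ring)
    (by intro c x y
        simp only [sympInner, smul_eq_mul, Finset.mul_sum, Pi.smul_apply]
        exact Finset.sum_congr rfl fun i _ => by ring)
    (by intro x y y'
        simp only [sympInner, ← Finset.sum_add_distrib, Pi.add_apply]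
        exact Finset.sum_congr rfl fun i _ => by ring)
    (by intro c x y
        simp only [sympInner, smul_eq_mul, Finset.mul_sum, Pi.smul_apply]
        exact Finset.sum_congr rfl fun i _ => by ring)

lemma sForm_alt (n : ℕ) (x : Fin (2 * n) → K) : sForm K n x x = 0 := by
  simp only [sForm, LinearMap.mk₂_apply, sympInner]
  exact Finset.sum_eq_zero fun i _ => by ring

lemma sForm_nd (n : ℕ) : SND (sForm K n) ⊤ := by
  intro y _ h
  funext j
  rw [Pi.zero_apply]
  by_cases hj : j.1 < n
  · have := h (Pi.single ⟨n + j.1, by omega⟩ 1) trivial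
    simp only [sForm, LinearMap.mk₂_apply, sympInner] at this
    rw [Finset.sum_eq_single (⟨j.1, hj⟩ : Fin n)] at this
    · simpa [Pi.single_apply, Fin.ext_iff, show n ≠ 0 by omega] using this
    · intro b _ hb
      have hb' : b.1 ≠ j.1 := fun h => hb (Fin.ext h)
      simp [Pi.single_apply, Fin.ext_iff, hb', show b.1 ≠ n + j.1 by omega]
    · simp
  · have hj2 : j.1 - n < n := by omega
    have := h (Pi.single ⟨j.1 - n, by omega⟩ 1) trivial
    simp only [sForm, LinearMap.mk₂_apply, sympInner] at this
    rw [Finset.sum_eq_single (⟨j.1 - n, hj2⟩ : Fin n)] at this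
    · simpa [Pi.single_apply, Fin.ext_iff, show n + (j.1 - n) = j.1 by omega,
        show j.1 ≠ j.1 - n by omega] using this
    · intro b _ hb
      have hb' : b.1 ≠ j.1 - n := fun h => hb (Fin.ext h)
      simp [Pi.single_apply, Fin.ext_iff, hb', show n + b.1 ≠ j.1 - n by omega]
    · simp

lemma sForm_iff (n : ℕ) (C : Submodule K (Fin (2 * n) → K)) :
    C ⊓ sympDual n C = ⊥ ↔ SND (sForm K n) C := by
  rw [Submodule.eq_bot_iff]
  constructor
  · intro h y hy hy'
    exact h y ⟨hy, hy'⟩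
  · rintro h y ⟨hy, hy'⟩
    exact h y hy hy'

end helpers

/-- The number of symplectic LCD `[2n,2k]_q` codes equals
`q^{2k(n-k)} · [n choose k]_{q²}`. -/
theorem card_symplecticLCD
    (q : ℕ) (hq : IsPrimePow q)
    {K : Type*} [Field K] [Fintype K] (hK : Fintype.card K = q)
    (n k : ℕ) (hk : 0 < k) (hkn : k < n) :
    (Nat.card {C : Submodule K (Fin (2 * n) → K) //
        Module.finrank K C = 2 * k ∧ C ⊓ sympDual n C = ⊥} : ℚ) =
      (q : ℚ) ^ (2 * k * (n - k)) *
        ∏ i ∈ Finset.range k,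
          ((q : ℚ) ^ (2 * (n - i)) - 1) / ((q : ℚ) ^ (2 * (k - i)) - 1) := by
  have hq1 : 1 < q := hq.one_lt
  have key := card_SND (sForm_alt (K := K) n) (sForm_nd n) n k (by simp)
  simp only [← sForm_iff] at key
  rw [hK] at key
  have hq1' : (1 : ℚ) < q := by exact_mod_cast hq1
  have hq0 : (q : ℚ) ≠ 0 := by positivity
  have hc : ∀ m : ℕ, (SCnt q m k : ℚ) =
      ∏ i ∈ Finset.range k, (((q : ℚ) ^ (2 * (m - i)) - 1) * (q : ℚ) ^ (2 * (m - i) - 1)) := by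
    intro m
    rw [SCnt, Nat.cast_prod]
    refine Finset.prod_congr rfl fun i _ => ?_
    rw [Nat.cast_mul, Nat.cast_sub (Nat.one_le_pow _ _ (by omega))]
    push_cast
    rfl
  have hne : ∀ i ∈ Finset.range k, ((q : ℚ) ^ (2 * (k - i)) - 1) ≠ 0 := by
    intro i hi
    have hi := Finset.mem_range.1 hi
    have := one_lt_pow₀ hq1' (n := 2 * (k - i)) (by omega)
    linarith
  have hne2 : (SCnt q k k : ℚ) ≠ 0 := by
    rw [hc]
    exact Finset.prod_ne_zero_iff.2 fun i hi => mul_ne_zero (hne i hi) (pow_ne_zero _ hq0)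
  have key' : (_ : ℚ) = _ := congrArg (Nat.cast : ℕ → ℚ) key
  rw [Nat.cast_mul] at key'
  apply mul_right_cancel₀ hne2
  rw [key', hc, hc]
  have hp : (q : ℚ) ^ (2 * k * (n - k)) = ∏ i ∈ Finset.range k, (q : ℚ) ^ (2 * (n - k)) := by
    rw [Finset.prod_const, Finset.card_range, ← pow_mul]
    congr 1
    ring
  rw [hp, ← Finset.prod_mul_distrib, ← Finset.prod_mul_distrib]
  refine Finset.prod_congr rfl fun i hi => ?_
  have h1 := hne i hi
  have hi := Finset.mem_range.1 hi
  have h2 : 2 * (n - i) - 1 = 2 * (n - k) + (2 * (k - i) - 1) := by omega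
  rw [h2, pow_add]
  field_simp
end
end

section
/- Let q be a prime power, let n, k be integers with 1 ≤ k ≤ n, and let u be a fixed nonzero vector in F_q^{2n}. The number of distinct symplectic self-orthogonal [2n,k]_q codes containing u equals ∏_{i=1}^{k−1} (q^{2n−2i} − 1)/(q^i − 1), i.e., (q^{2n−2k+2} − 1)(q^{2n−2k+4} − 1) ⋯ (q^{2n−2} − 1) / ( (q^{k−1} − 1) ⋯ (q − 1) ). -/
open scoped BigOperators
open Matrix

noncomputable section

section Helpers

variable {K : Type*} [Field K]

lemma sympInner_add_left (n : ℕ) (x y z : Fin (2 * n) → K) :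
    sympInner n (x + y) z = sympInner n x z + sympInner n y z := by
  simp only [sympInner, Pi.add_apply, ← Finset.sum_add_distrib]
  exact Finset.sum_congr rfl fun i _ => by ring

lemma sympInner_smul_left (n : ℕ) (c : K) (x z : Fin (2 * n) → K) :
    sympInner n (c • x) z = c * sympInner n x z := by
  simp only [sympInner, Pi.smul_apply, smul_eq_mul, Finset.mul_sum]
  exact Finset.sum_congr rfl fun i _ => by ring

lemma sympInner_symm (n : ℕ) (x y : Fin (2 * n) → K) :
    sympInner n x y = - sympInner n y x := by
  simp only [sympInner, ← Finset.sum_neg_distrib]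
  exact Finset.sum_congr rfl fun i _ => by ring

lemma sympInner_self (n : ℕ) (x : Fin (2 * n) → K) : sympInner n x x = 0 := by
  simp only [sympInner]
  exact Finset.sum_eq_zero fun i _ => by ring

lemma sympInner_add_right (n : ℕ) (x y z : Fin (2 * n) → K) :
    sympInner n x (y + z) = sympInner n x y + sympInner n x z := by
  rw [sympInner_symm, sympInner_add_left, sympInner_symm n y, sympInner_symm n z]; ring

lemma sympInner_smul_right (n : ℕ) (c : K) (x z : Fin (2 * n) → K) :
    sympInner n x (c • z) = c * sympInner n x z := by
  rw [sympInner_symm, sympInner_smul_left, sympInner_symm n z]; ring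

/-- The symplectic product as a bilinear form. -/
def sympB (n : ℕ) : LinearMap.BilinForm K (Fin (2 * n) → K) :=
  LinearMap.mk₂ K (sympInner n) (sympInner_add_left n) (sympInner_smul_left n)
    (sympInner_add_right n) (sympInner_smul_right n)

lemma sympB_ker (n : ℕ) : LinearMap.ker (sympB n : LinearMap.BilinForm K (Fin (2 * n) → K)) = ⊥ := by
  rw [LinearMap.ker_eq_bot']
  intro x hx
  have h : ∀ y, sympInner n x y = 0 := fun y => by
    have := LinearMap.congr_fun hx y
    simpa [sympB] using this
  funext j
  by_cases hj : j.1 < n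
  · have := h (Pi.single ⟨n + j.1, by omega⟩ 1)
    rw [sympInner, Finset.sum_eq_single ⟨j.1, hj⟩] at this
    · simp [Pi.single_apply, Fin.ext_iff] at this
      rw [if_neg (by omega)] at this
      simpa using this
    · intro b _ hb
      have hb' : b.1 ≠ j.1 := fun h => hb (Fin.ext h)
      have := b.2
      simp [Pi.single_apply, Fin.ext_iff, hb']
      omega
    · simp
  · have hj2 := j.2
    have := h (Pi.single ⟨j.1 - n, by omega⟩ 1)
    rw [sympInner, Finset.sum_eq_single ⟨j.1 - n, by omega⟩] at this
    · simp [Pi.single_apply, Fin.ext_iff, (by omega : n + (j.1 - n) = j.1)] at this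
      rw [if_neg (by omega)] at this
      simpa using this
    · intro b _ hb
      have hb' : b.1 ≠ j.1 - n := fun h => hb (Fin.ext h)
      have := b.2
      simp [Pi.single_apply, Fin.ext_iff, hb']
      omega
    · simp

lemma finrank_sympDual (n : ℕ) (C : Submodule K (Fin (2 * n) → K)) :
    Module.finrank K C + Module.finrank K (sympDual n C) = 2 * n := by
  have h := LinearMap.BilinForm.finrank_add_finrank_orthogonal' (B := sympB n) C
  have h2 : (sympB n).orthogonal C = sympDual n C := by
    ext y; rfl
  rw [h2, sympB_ker, inf_bot_eq, finrank_bot] at h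
  simpa using h

/-- Span of `u` and the tuple `v`. -/
def spanU {n : ℕ} (u : Fin (2 * n) → K) {j : ℕ} (v : Fin j → Fin (2 * n) → K) :
    Submodule K (Fin (2 * n) → K) :=
  Submodule.span K (insert u (Set.range v))

lemma spanU_snoc {n : ℕ} (u : Fin (2 * n) → K) {j : ℕ} (v : Fin j → Fin (2 * n) → K)
    (w : Fin (2 * n) → K) :
    spanU u (Fin.snoc v w : Fin (j + 1) → Fin (2 * n) → K) = spanU u v ⊔ Submodule.span K {w} := by
  rw [spanU, spanU, Fin.range_snoc, Set.insert_comm, Submodule.span_insert, sup_comm]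

lemma finrank_spanU_le {n : ℕ} (u : Fin (2 * n) → K) {j : ℕ} (v : Fin j → Fin (2 * n) → K) :
    Module.finrank K (spanU u v) ≤ j + 1 := by
  classical
  have : insert u (Set.range v) = Set.range (Fin.cons u v : Fin (j + 1) → Fin (2 * n) → K) := by
    rw [Fin.range_cons]
  rw [spanU, this]
  have h := finrank_range_le_card (R := K) (Fin.cons u v : Fin (j + 1) → Fin (2 * n) → K)
  rw [Fintype.card_fin] at h
  exact h

/-- Good tuples inside `W`. -/
def Good {n : ℕ} (u : Fin (2 * n) → K) (W : Submodule K (Fin (2 * n) → K)) (j : ℕ)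
    (v : Fin j → Fin (2 * n) → K) : Prop :=
  spanU u v ≤ W ∧ Module.finrank K (spanU u v) = j + 1 ∧ spanU u v ≤ sympDual n (spanU u v)

lemma isotropic_sup {n : ℕ} (D : Submodule K (Fin (2 * n) → K)) (w : Fin (2 * n) → K) :
    D ⊔ Submodule.span K {w} ≤ sympDual n (D ⊔ Submodule.span K {w}) ↔
      D ≤ sympDual n D ∧ w ∈ sympDual n D := by
  constructor
  · intro h
    have hw : w ∈ D ⊔ Submodule.span K {w} :=
      Submodule.mem_sup_right (Submodule.mem_span_singleton_self w)
    exact ⟨fun y hy x hx => h (Submodule.mem_sup_left hy) x (Submodule.mem_sup_left hx),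
      fun x hx => h hw x (Submodule.mem_sup_left hx)⟩
  · rintro ⟨h1, h2⟩ y hy x hx
    obtain ⟨y1, hy1, y2, hy2, rfl⟩ := Submodule.mem_sup.1 hy
    obtain ⟨x1, hx1, x2, hx2, rfl⟩ := Submodule.mem_sup.1 hx
    obtain ⟨a, rfl⟩ := Submodule.mem_span_singleton.1 hy2
    obtain ⟨b, rfl⟩ := Submodule.mem_span_singleton.1 hx2
    simp only [sympInner_add_left, sympInner_add_right, sympInner_smul_left,
      sympInner_smul_right, sympInner_self]
    rw [sympInner_symm n w y1, h1 hy1 x1 hx1, h2 x1 hx1, h2 y1 hy1]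
    ring

lemma good_snoc {n : ℕ} (u : Fin (2 * n) → K) (W : Submodule K (Fin (2 * n) → K)) (j : ℕ)
    (v : Fin j → Fin (2 * n) → K) (w : Fin (2 * n) → K) :
    Good u W (j + 1) (Fin.snoc v w : Fin (j + 1) → Fin (2 * n) → K) ↔
      Good u W j v ∧ (w ∈ W ⊓ sympDual n (spanU u v) ∧ w ∉ spanU u v) := by
  unfold Good
  rw [spanU_snoc, isotropic_sup, sup_le_iff, Submodule.span_singleton_le_iff_mem,
    Submodule.mem_inf]
  by_cases hw : w ∈ spanU u v
  · have : spanU u v ⊔ Submodule.span K {w} = spanU u v := by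
      rwa [sup_eq_left, Submodule.span_singleton_le_iff_mem]
    rw [this]
    have := finrank_spanU_le u v
    constructor
    · rintro ⟨_, h, _⟩; omega
    · tauto
  · rw [Submodule.finrank_sup_span_singleton hw]
    constructor
    · rintro ⟨⟨a, b⟩, c, d, e⟩
      exact ⟨⟨a, by omega, d⟩, ⟨b, e⟩, hw⟩
    · rintro ⟨⟨a, c, d⟩, ⟨b, e⟩, _⟩
      exact ⟨⟨a, b⟩, by omega, d, e⟩

/-- Splitting off the last vector. -/
def goodEquiv {n : ℕ} (u : Fin (2 * n) → K) (W : Submodule K (Fin (2 * n) → K)) (j : ℕ) :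
    {v // Good u W (j + 1) v} ≃
      Σ v : {v // Good u W j v}, {w // w ∈ W ⊓ sympDual n (spanU u v.1) ∧ w ∉ spanU u v.1} where
  toFun v := by
    have h := (good_snoc u W j (Fin.init v.1) (v.1 (Fin.last j))).1
      (by rw [Fin.snoc_init_self]; exact v.2)
    exact ⟨⟨Fin.init v.1, h.1⟩, ⟨v.1 (Fin.last j), h.2⟩⟩
  invFun p := ⟨Fin.snoc p.1.1 p.2.1, (good_snoc u W j _ _).2 ⟨p.1.2, p.2.2⟩⟩
  left_inv v := by
    apply Subtype.ext
    exact Fin.snoc_init_self v.1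
  right_inv p := by
    obtain ⟨⟨v, hv⟩, ⟨w, hw⟩⟩ := p
    have h1 : Fin.init (Fin.snoc v w : Fin (j + 1) → Fin (2 * n) → K) = v := Fin.init_snoc _ _
    have h2 : (Fin.snoc v w : Fin (j + 1) → Fin (2 * n) → K) (Fin.last j) = w := Fin.snoc_last _ _
    apply Sigma.ext
    · exact Subtype.ext h1
    · dsimp only
      congr! 1
      simp only [h1]

lemma card_sdiff_sub [Fintype K] {n : ℕ} (D A : Submodule K (Fin (2 * n) → K)) (h : D ≤ A) :
    (Nat.card {w // w ∈ A ∧ w ∉ D} : ℚ) =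
      (Fintype.card K : ℚ) ^ Module.finrank K A - (Fintype.card K : ℚ) ^ Module.finrank K D := by
  have e : Nat.card {w // w ∈ A ∧ w ∉ D} = ((A : Set (Fin (2 * n) → K)) \ D).ncard := rfl
  have h1 := Set.ncard_sdiff_add_ncard_of_subset (s := (D : Set (Fin (2 * n) → K)))
    (t := (A : Set (Fin (2 * n) → K))) h (Set.toFinite _)
  have hA : (A : Set (Fin (2 * n) → K)).ncard = Fintype.card K ^ Module.finrank K A := by
    rw [← Nat.card_eq_fintype_card]
    exact Module.natCard_eq_pow_finrank (K := K) (V := A)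
  have hD : (D : Set (Fin (2 * n) → K)).ncard = Fintype.card K ^ Module.finrank K D := by
    rw [← Nat.card_eq_fintype_card]
    exact Module.natCard_eq_pow_finrank (K := K) (V := D)
  rw [hA, hD] at h1
  rw [e, eq_sub_iff_add_eq]
  exact_mod_cast h1

lemma card_good [Fintype K] {n : ℕ} (u : Fin (2 * n) → K) (hu : u ≠ 0)
    (W : Submodule K (Fin (2 * n) → K)) (huW : u ∈ W) (a : ℕ → ℕ)
    (ha : ∀ D : Submodule K (Fin (2 * n) → K), D ≤ W → D ≤ sympDual n D →
      Module.finrank K ↥(W ⊓ sympDual n D) = a (Module.finrank K D)) (j : ℕ) :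
    (Nat.card {v // Good u W j v} : ℚ) =
      ∏ i ∈ Finset.range j, ((Fintype.card K : ℚ) ^ a (i + 1) - (Fintype.card K : ℚ) ^ (i + 1)) := by
  classical
  induction j with
  | zero =>
    have hs : ∀ v : Fin 0 → Fin (2 * n) → K, spanU u v = Submodule.span K {u} := by
      intro v; simp [spanU]
    have hg : ∀ v : Fin 0 → Fin (2 * n) → K, Good u W 0 v := by
      intro v
      refine ⟨?_, ?_, ?_⟩
      · rw [hs, Submodule.span_singleton_le_iff_mem]; exact huW
      · rw [hs, finrank_span_singleton hu]
      · rw [hs]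
        have := (isotropic_sup (⊥ : Submodule K (Fin (2 * n) → K)) u).2
          ⟨bot_le, by
            intro x hx
            rw [Submodule.mem_bot] at hx
            subst hx; simp [sympInner]⟩
        simpa using this
    have : Nat.card {v // Good u W 0 v} = 1 := by
      rw [Nat.card_congr (Equiv.subtypeUnivEquiv hg)]
      simp
    rw [this]; simp
  | succ j ih =>
    rw [Nat.card_congr (goodEquiv u W j)]
    haveI : Fintype {v // Good u W j v} := Fintype.ofFinite _
    rw [Nat.card_sigma, Nat.cast_sum, Finset.prod_range_succ, ← ih]
    rw [Finset.sum_congr rfl (g := fun _ =>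
      ((Fintype.card K : ℚ) ^ a (j + 1) - (Fintype.card K : ℚ) ^ (j + 1)))]
    · rw [Finset.sum_const, Finset.card_univ, nsmul_eq_mul, Nat.card_eq_fintype_card]
    · rintro ⟨v, hv⟩ -
      rw [card_sdiff_sub _ _ (le_inf hv.1 hv.2.2), ha _ hv.1 hv.2.2, hv.2.1]

/-- Sorting good tuples by their span. -/
def goodFiber {n : ℕ} (u : Fin (2 * n) → K) (j : ℕ) :
    {v // Good u ⊤ j v} ≃
      Σ C : {C : Submodule K (Fin (2 * n) → K) //
        Module.finrank K C = j + 1 ∧ C ≤ sympDual n C ∧ u ∈ C}, {v // Good u C.1 j v} where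
  toFun v := ⟨⟨spanU u v.1, v.2.2.1, v.2.2.2,
    Submodule.subset_span (Set.mem_insert _ _)⟩, ⟨v.1, le_rfl, v.2.2⟩⟩
  invFun p := ⟨p.2.1, le_top, p.2.2.2⟩
  left_inv v := rfl
  right_inv p := by
    obtain ⟨⟨C, hC⟩, ⟨v, hv⟩⟩ := p
    have h : spanU u v = C := Submodule.eq_of_le_of_finrank_eq hv.1 (by rw [hv.2.1, hC.1])
    subst h
    rfl

end Helpers

/-- Given a nonzero vector `u ∈ F_q^{2n}`, the number of symplectic
self-orthogonal `[2n,k]_q` codes containing `u` equals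
`∏_{i=1}^{k-1} (q^{2n-2i} - 1)/(q^i - 1)`. -/
theorem card_symplectic_selfOrthogonal_containing
    (q : ℕ) (hq : IsPrimePow q)
    {K : Type*} [Field K] [Fintype K] (hK : Fintype.card K = q)
    (n k : ℕ) (hk : 1 ≤ k) (hkn : k ≤ n)
    (u : Fin (2 * n) → K) (hu : u ≠ 0) :
    (Nat.card {C : Submodule K (Fin (2 * n) → K) //
        Module.finrank K C = k ∧ C ≤ sympDual n C ∧ u ∈ C} : ℚ) =
      ∏ i ∈ Finset.Icc 1 (k - 1), ((q : ℚ) ^ (2 * n - 2 * i) - 1) / ((q : ℚ) ^ i - 1) := by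

  classical
  obtain ⟨j, rfl⟩ : ∃ j, k = j + 1 := ⟨k - 1, by omega⟩
  have hq1 : (1 : ℚ) < q := by exact_mod_cast hq.one_lt
  have hq0 : (q : ℚ) ≠ 0 := by positivity
  have hpow : ∀ i : ℕ, i ≠ 0 → (q : ℚ) ^ i - 1 ≠ 0 := fun i hi =>
    (sub_pos.2 (one_lt_pow₀ hq1 hi)).ne'
  have hT := card_good u hu ⊤ trivial (fun i => 2 * n - i) (by
    intro D _ _
    have := finrank_sympDual n D
    rw [top_inf_eq]; omega) j
  have hC : ∀ C : {C : Submodule K (Fin (2 * n) → K) //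
        Module.finrank K C = j + 1 ∧ C ≤ sympDual n C ∧ u ∈ C},
      (Nat.card {v // Good u C.1 j v} : ℚ) =
        ∏ i ∈ Finset.range j, ((q : ℚ) ^ (j + 1) - (q : ℚ) ^ (i + 1)) := by
    rintro ⟨C, h1, h2, h3⟩
    rw [← hK]
    refine card_good u hu C h3 (fun _ => j + 1) ?_ j
    intro D hD _
    have : C ⊓ sympDual n D = C := inf_eq_left.2 (fun y hy x hx => h2 hy x (hD hx))
    rw [this, h1]
  rw [Nat.card_congr (goodFiber u j)] at hT
  haveI : Fintype {C : Submodule K (Fin (2 * n) → K) //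
        Module.finrank K C = j + 1 ∧ C ≤ sympDual n C ∧ u ∈ C} := Fintype.ofFinite _
  rw [Nat.card_sigma, Nat.cast_sum, Finset.sum_congr rfl (fun C _ => hC C), hK] at hT
  rw [Finset.sum_const, Finset.card_univ, nsmul_eq_mul, ← Nat.card_eq_fintype_card] at hT
  have e1 : ∏ i ∈ Finset.range j, ((q : ℚ) ^ (j + 1) - (q : ℚ) ^ (i + 1)) =
      (∏ i ∈ Finset.range j, (q : ℚ) ^ (i + 1)) * ∏ i ∈ Finset.range j, ((q : ℚ) ^ (i + 1) - 1) := by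
    rw [← Finset.prod_range_reflect (fun i => (q : ℚ) ^ (i + 1) - 1), ← Finset.prod_mul_distrib]
    refine Finset.prod_congr rfl fun i hi => ?_
    have := Finset.mem_range.1 hi
    rw [mul_sub, ← pow_add, mul_one]
    congr 2; omega
  have e2 : ∏ i ∈ Finset.range j, ((q : ℚ) ^ (2 * n - (i + 1)) - (q : ℚ) ^ (i + 1)) =
      (∏ i ∈ Finset.range j, (q : ℚ) ^ (i + 1)) *
        ∏ i ∈ Finset.range j, ((q : ℚ) ^ (2 * n - 2 * (i + 1)) - 1) := by
    rw [← Finset.prod_mul_distrib]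
    refine Finset.prod_congr rfl fun i hi => ?_
    have := Finset.mem_range.1 hi
    rw [mul_sub, ← pow_add, mul_one]
    congr 2; omega
  have hP : (∏ i ∈ Finset.range j, (q : ℚ) ^ (i + 1)) ≠ 0 :=
    Finset.prod_ne_zero_iff.2 fun i _ => pow_ne_zero _ hq0
  have hR : (∏ i ∈ Finset.range j, ((q : ℚ) ^ (i + 1) - 1)) ≠ 0 :=
    Finset.prod_ne_zero_iff.2 fun i _ => hpow _ (by omega)
  have e3 : Finset.Icc 1 (j + 1 - 1) = Finset.Ico 1 (j + 1) := by
    ext x; simp only [Finset.mem_Icc, Finset.mem_Ico]; omega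
  rw [e3, Finset.prod_Ico_eq_prod_range, Finset.prod_div_distrib, eq_div_iff (by
    simpa [add_comm] using hR)]
  simp only [e1, e2] at hT
  apply mul_left_cancel₀ hP
  simp only [Nat.add_sub_cancel, add_comm 1]
  rw [← hT]; ring
end
end

section
/- Let q be a prime power and fix a nonnegative integer ℓ. Then, as k₀ → ∞ and n − k₀ → ∞ (with k = 2k₀ + ℓ ≤ 2n), the ratio |SHull[2n,k]_q^ℓ| / [2n choose k]_q converges to q^ℓ · g_{q,∞} / ( h_{q,ℓ} · g_{q²,∞} ), where h_{Q,ℓ} = ∏_{i=1}^{ℓ}(Q^i − 1) and g_{Q,∞} = ∏_{i=1}^{∞}(1 − Q^{−i}). In particular, for ℓ = 0 the ratio of the number of symplectic LCD [2n,2k₀]_q codes to [2n choose 2k₀]_q converges to g_{q,∞} / g_{q²,∞}. -/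
open scoped BigOperators
open Matrix

noncomputable section

/-- `g_{Q,∞} = ∏_{i=1}^{∞} (1 - Q^{-i})`. -/
def ginfty (Q : ℝ) : ℝ := ∏' i : ℕ, (1 - Q⁻¹ ^ (i + 1))

/-- `h_{Q,ℓ} = ∏_{i=1}^{ℓ} (Q^i - 1)`. -/
def hpoly (Q : ℝ) (ℓ : ℕ) : ℝ := ∏ i ∈ Finset.Icc 1 ℓ, (Q ^ i - 1)

/-- The Gaussian binomial coefficient `[n choose k]_Q = ∏_{i=0}^{k-1} (Q^{n-i}-1)/(Q^{k-i}-1)`. -/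
def gaussBinom (Q : ℝ) (n k : ℕ) : ℝ :=
  ∏ i ∈ Finset.range k, (Q ^ (n - i) - 1) / (Q ^ (k - i) - 1)
/-- partial products of `ginfty` -/
def gpart (Q : ℝ) (m : ℕ) : ℝ := ∏ i ∈ Finset.range m, (1 - Q⁻¹ ^ (i + 1))

lemma gpart_succ (Q : ℝ) (m : ℕ) : gpart Q (m+1) = gpart Q m * (1 - Q⁻¹ ^ (m + 1)) := by
  simp [gpart, Finset.prod_range_succ]

lemma gfac_pos {Q : ℝ} (hQ : 1 < Q) (i : ℕ) : 0 < 1 - Q⁻¹ ^ (i + 1) := by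
  have h0 : 0 ≤ Q⁻¹ := by positivity
  have := pow_lt_one₀ h0 (inv_lt_one_of_one_lt₀ hQ) (Nat.succ_ne_zero i)
  simpa using this

lemma gpart_pos {Q : ℝ} (hQ : 1 < Q) (m : ℕ) : 0 < gpart Q m :=
  Finset.prod_pos fun i _ => gfac_pos hQ i

lemma summable_aux {Q : ℝ} (hQ : 1 < Q) : Summable fun i : ℕ => ‖-(Q⁻¹ ^ (i + 1))‖ := by
  have h0 : 0 ≤ Q⁻¹ := by positivity
  have h : Summable fun i : ℕ => Q⁻¹ ^ (i + 1) :=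
    (summable_nat_add_iff 1).2 (summable_geometric_of_lt_one h0 (inv_lt_one_of_one_lt₀ hQ))
  refine h.congr fun i => ?_
  rw [norm_neg, Real.norm_of_nonneg (by positivity)]

lemma gpart_tendsto {Q : ℝ} (hQ : 1 < Q) :
    Filter.Tendsto (gpart Q) Filter.atTop (nhds (ginfty Q)) := by
  have h := multipliable_one_add_of_summable (summable_aux hQ)
  simp only [← sub_eq_add_neg] at h
  exact h.tendsto_prod_tprod_nat

lemma ginfty_ne {Q : ℝ} (hQ : 1 < Q) : ginfty Q ≠ 0 := by
  have := tprod_one_add_ne_zero_of_summable (f := fun i : ℕ => -(Q⁻¹ ^ (i + 1))) (fun i => by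
    have := gfac_pos hQ i
    rw [← sub_eq_add_neg]; exact this.ne') (summable_aux hQ)
  simp only [← sub_eq_add_neg] at this
  exact this

lemma pow_sub_one_eq {Q : ℝ} (hQ : 1 < Q) (m : ℕ) :
    Q ^ m - 1 = Q ^ m * (1 - Q⁻¹ ^ m) := by
  have : Q ^ m ≠ 0 := by positivity
  rw [inv_pow]; field_simp

lemma gaussBinom_eq {Q : ℝ} (hQ : 1 < Q) (a b : ℕ) :
    gaussBinom Q (a + b) a = Q ^ (a * b) * gpart Q (a + b) / (gpart Q a * gpart Q b) := by
  induction a with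
  | zero =>
    have := (gpart_pos hQ b).ne'
    simp only [gaussBinom, Finset.range_zero, Finset.prod_empty, zero_mul, pow_zero, one_mul,
      zero_add]
    rw [show gpart Q 0 = 1 by simp [gpart], one_mul, div_self this]
  | succ a ih =>
    have h1 : gaussBinom Q (a + 1 + b) (a + 1) =
        gaussBinom Q (a + b) a * ((Q ^ (a + 1 + b) - 1) / (Q ^ (a + 1) - 1)) := by
      unfold gaussBinom
      rw [Finset.prod_range_succ']
      congr 1
      refine Finset.prod_congr rfl fun i _ => ?_
      congr 3 <;> omega
    rw [h1, ih, show a + 1 + b = (a + b) + 1 by ring, gpart_succ, gpart_succ,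
      pow_sub_one_eq hQ, pow_sub_one_eq hQ]
    have h2 := (gpart_pos hQ b).ne'
    have h3 := (gpart_pos hQ a).ne'
    have h4 := (gfac_pos hQ a).ne'
    have h5 : Q ≠ 0 := by positivity
    generalize 1 - Q⁻¹ ^ (a + 1) = X at *
    generalize 1 - Q⁻¹ ^ (a + b + 1) = Y at *
    field_simp
    ring

/-- target closed form for the count -/
def cform (Q : ℝ) (k l s : ℕ) : ℝ :=
  Q ^ (4*k*s + 2*k*l + 2*s*l + l^2 + l) * gpart (Q^2) (k + l + s) /
    (gpart (Q^2) k * gpart (Q^2) s * hpoly Q l)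

lemma hpoly_succ (Q : ℝ) (l : ℕ) : hpoly Q (l+1) = hpoly Q l * (Q^(l+1) - 1) := by
  unfold hpoly
  rw [Finset.prod_Icc_succ_top (by omega)]

lemma hpoly_pos {Q : ℝ} (hQ : 1 < Q) (l : ℕ) : 0 < hpoly Q l := by
  refine Finset.prod_pos fun i hi => ?_
  have := one_lt_pow₀ hQ (show i ≠ 0 by simp at hi; omega)
  linarith

lemma one_lt_sq' {Q : ℝ} (hQ : 1 < Q) : 1 < Q^2 := one_lt_pow₀ hQ (by norm_num)

lemma cform_step {Q : ℝ} (hQ : 1 < Q) (k l s : ℕ) :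
    cform Q (k+1) l s * ((Q^(2*(k+1)+l) - Q^l) * Q^(2*k+1+l)) =
      (Q^(2*(k+1+l+s)) - 1) * Q^(2*(k+l+s)+1) * cform Q k l s := by
  have e1 : Q^(2*(k+1)+l) - Q^l = Q^l * ((Q^2)^(k+1) * (1 - (Q^2)⁻¹ ^ (k+1))) := by
    rw [← pow_sub_one_eq (one_lt_sq' hQ)]; ring
  have e2 : Q^(2*(k+1+l+s)) - 1 = (Q^2)^(k+l+s+1) * (1 - (Q^2)⁻¹ ^ (k+l+s+1)) := by
    rw [← pow_sub_one_eq (one_lt_sq' hQ)]; ring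
  rw [e1, e2]
  unfold cform
  rw [show k + 1 + l + s = (k + l + s) + 1 by ring, gpart_succ, gpart_succ]
  have h2 := (gpart_pos (one_lt_sq' hQ) k).ne'
  have h3 := (gpart_pos (one_lt_sq' hQ) s).ne'
  have h4 := (gfac_pos (one_lt_sq' hQ) k).ne'
  have h5 : Q ≠ 0 := by positivity
  have h6 := (hpoly_pos hQ l).ne'
  generalize 1 - (Q^2)⁻¹ ^ (k + 1) = X at *
  generalize 1 - (Q^2)⁻¹ ^ (k + l + s + 1) = Y at *
  field_simp
  ring

lemma prodA (Q : ℝ) (l : ℕ) :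
    ∏ j ∈ Finset.range l, (Q^l - Q^j) = (∏ j ∈ Finset.range l, Q^j) * hpoly Q l := by
  have : hpoly Q l = ∏ j ∈ Finset.range l, (Q^(l-j) - 1) := by
    induction l with
    | zero => simp [hpoly]
    | succ l ih =>
      rw [hpoly_succ, ih, Finset.prod_range_succ']
      simp
  rw [this, ← Finset.prod_mul_distrib]
  refine Finset.prod_congr rfl fun j hj => ?_
  have : j < l := by simpa using hj
  rw [mul_sub, ← pow_add, mul_one]
  congr 2; omega

lemma prodB {Q : ℝ} (hQ : 1 < Q) (l s : ℕ) :
    ∏ j ∈ Finset.range l, ((Q^2)^(l+s-j) - 1) =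
      Q ^ (2*s*l+l^2+l) * gpart (Q^2) (l+s) / gpart (Q^2) s := by
  have h3 := (gpart_pos (one_lt_sq' hQ) s).ne'
  induction l with
  | zero => simp; field_simp
  | succ l ih =>
    rw [Finset.prod_range_succ']
    have : ∀ j, l + 1 + s - (j+1) = l + s - j := by intro j; omega
    simp only [this]
    rw [ih, show l + 1 + s - 0 = (l + s) + 1 by omega, show l + 1 + s = (l + s) + 1 by omega,
      gpart_succ, pow_sub_one_eq (one_lt_sq' hQ)]
    have h5 : Q ≠ 0 := by positivity
    generalize 1 - (Q^2)⁻¹ ^ (l + s + 1) = Y at *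
    field_simp
    ring

lemma cform_base {Q : ℝ} (hQ : 1 < Q) (l s : ℕ) :
    cform Q 0 l s * ∏ j ∈ Finset.range l, (Q^l - Q^j) =
      ∏ j ∈ Finset.range l, (Q^(2*(l+s)-j) - Q^j) := by
  have e : ∏ j ∈ Finset.range l, (Q^(2*(l+s)-j) - Q^j) =
      (∏ j ∈ Finset.range l, Q^j) * ∏ j ∈ Finset.range l, ((Q^2)^(l+s-j) - 1) := by
    rw [← Finset.prod_mul_distrib]
    refine Finset.prod_congr rfl fun j hj => ?_
    have : j < l := by simpa using hj
    rw [mul_sub, ← pow_mul, ← pow_add, mul_one]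
    congr 2; omega
  rw [e, prodA, prodB hQ, cform]
  have h3 := (gpart_pos (one_lt_sq' hQ) s).ne'
  have h6 := (hpoly_pos hQ l).ne'
  simp [gpart] at *
  field_simp

lemma ratio_eq {Q : ℝ} (hQ : 1 < Q) (k l s : ℕ) :
    cform Q k l s / gaussBinom Q (2 * (k + l + s)) (2 * k + l) =
      Q ^ l / hpoly Q l * (gpart (Q^2) (k+l+s) * gpart Q (2*k+l) * gpart Q (2*s+l) /
        (gpart (Q^2) k * gpart (Q^2) s * gpart Q (2*(k+l+s)))) := by
  rw [show 2 * (k + l + s) = (2*k+l) + (2*s+l) by ring, gaussBinom_eq hQ, cform]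
  have h1 := (gpart_pos (one_lt_sq' hQ) s).ne'
  have h2 := (gpart_pos (one_lt_sq' hQ) k).ne'
  have h3 := (gpart_pos hQ (2*k+l)).ne'
  have h4 := (gpart_pos hQ (2*s+l)).ne'
  have h5 := (gpart_pos hQ ((2*k+l) + (2*s+l))).ne'
  have h6 := (hpoly_pos hQ l).ne'
  have h7 : Q ≠ 0 := by positivity
  field_simp
  ring

lemma ratio_tendsto {Q : ℝ} (hQ : 1 < Q) (l : ℕ) :
    Filter.Tendsto (fun p : ℕ × ℕ => cform Q p.1 l p.2 /
      gaussBinom Q (2 * (p.1 + l + p.2)) (2 * p.1 + l)) (Filter.atTop)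
      (nhds (Q ^ l * ginfty Q / (hpoly Q l * ginfty (Q^2)))) := by
  simp only [ratio_eq hQ]
  have n1 := ginfty_ne hQ
  have n2 := ginfty_ne (one_lt_sq' hQ)
  have n3 := (hpoly_pos hQ l).ne'
  have t1 := gpart_tendsto hQ
  have t2 := gpart_tendsto (one_lt_sq' hQ)
  have f1 : Filter.Tendsto (fun p : ℕ × ℕ => p.1) Filter.atTop Filter.atTop := by
    rw [← Filter.prod_atTop_atTop_eq]; exact Filter.tendsto_fst
  have f2 : Filter.Tendsto (fun p : ℕ × ℕ => p.2) Filter.atTop Filter.atTop := by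
    rw [← Filter.prod_atTop_atTop_eq]; exact Filter.tendsto_snd
  have g1 : Filter.Tendsto (fun p : ℕ × ℕ => p.1 + l + p.2) Filter.atTop Filter.atTop :=
    Filter.tendsto_atTop_mono (fun p => by omega) f1
  have g2 : Filter.Tendsto (fun p : ℕ × ℕ => 2 * p.1 + l) Filter.atTop Filter.atTop :=
    Filter.tendsto_atTop_mono (fun p => by omega) f1
  have g3 : Filter.Tendsto (fun p : ℕ × ℕ => 2 * p.2 + l) Filter.atTop Filter.atTop :=
    Filter.tendsto_atTop_mono (fun p => by omega) f2
  have g4 : Filter.Tendsto (fun p : ℕ × ℕ => 2 * (p.1 + l + p.2)) Filter.atTop Filter.atTop :=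
    Filter.tendsto_atTop_mono (fun p => by omega) f1
  have := ((((t2.comp g1).mul (t1.comp g2)).mul (t1.comp g3)).div
    (((t2.comp f1).mul (t2.comp f2)).mul (t1.comp g4)) (by positivity)).const_mul (Q ^ l / hpoly Q l)
  have e : Q ^ l * ginfty Q / (hpoly Q l * ginfty (Q^2)) = Q ^ l / hpoly Q l *
      (ginfty (Q ^ 2) * ginfty Q * ginfty Q / (ginfty (Q ^ 2) * ginfty (Q ^ 2) * ginfty Q)) := by
    field_simp
  rw [e]
  exact this
section linalg
open Module LinearMap

universe u w

lemma card_fiber {K : Type w} {V : Type u} [Field K] [Fintype K] [AddCommGroup V] [Module K V]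
    [Finite V] (φ : V →ₗ[K] K) (h : φ ≠ 0) :
    Nat.card {f : V // φ f = 1} = Fintype.card K ^ (finrank K V - 1) := by
  have : FiniteDimensional K V := Module.Finite.of_finite
  have hs : Function.Surjective φ := LinearMap.surjective h
  obtain ⟨f₀, hf₀⟩ := hs 1
  have e : {f : V // φ f = 1} ≃ LinearMap.ker φ :=
    { toFun := fun f => ⟨f.1 - f₀, by simp [f.2, hf₀]⟩
      invFun := fun g => ⟨g.1 + f₀, by simp [hf₀]⟩
      left_inv := fun f => by simp
      right_inv := fun g => by simp }
  rw [Nat.card_congr e, Module.natCard_eq_pow_finrank (K := K), Nat.card_eq_fintype_card]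
  have h1 := LinearMap.finrank_range_add_finrank_ker φ
  rw [LinearMap.range_eq_top.2 hs, finrank_top, finrank_self] at h1
  congr 1; omega

lemma card_diff {K : Type w} {V : Type u} [Field K] [Fintype K] [AddCommGroup V] [Module K V]
    [Finite V] (U P : Submodule K V) (h : U ≤ P) :
    Nat.card {x : V // x ∈ P ∧ x ∉ U} =
      Fintype.card K ^ finrank K P - Fintype.card K ^ finrank K U := by
  have : FiniteDimensional K V := Module.Finite.of_finite
  have h1 : Nat.card {x : V // x ∈ P ∧ x ∉ U} = ((P : Set V) \ U).ncard := rfl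
  rw [h1, Set.ncard_sdiff (by exact_mod_cast h) (Set.toFinite _)]
  rw [← Nat.card_coe_set_eq, ← Nat.card_coe_set_eq]
  have a1 := Module.natCard_eq_pow_finrank (K := K) (V := P)
  have a2 := Module.natCard_eq_pow_finrank (K := K) (V := U)
  rw [Nat.card_eq_fintype_card (α := K)] at a1 a2
  exact congrArg₂ _ a1 a2

lemma card_hyp {K : Type w} {V : Type u} [Field K] [Fintype K] [AddCommGroup V] [Module K V]
    [Finite V] (B : LinearMap.BilinForm K V) :
    Nat.card {p : V × V // B p.1 p.2 = 1} =
      (Fintype.card K ^ finrank K V - Fintype.card K ^ finrank K (LinearMap.ker B)) *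
        Fintype.card K ^ (finrank K V - 1) := by
  have e : {p : V × V // B p.1 p.2 = 1} ≃
      Σ e : {x : V // x ∈ (⊤ : Submodule K V) ∧ x ∉ LinearMap.ker B}, {f : V // B e.1 f = 1} :=
    { toFun := fun p => ⟨⟨p.1.1, by
        refine ⟨trivial, fun h => ?_⟩
        have := p.2
        rw [LinearMap.mem_ker.1 h] at this
        simp at this⟩, ⟨p.1.2, p.2⟩⟩
      invFun := fun x => ⟨(x.1.1, x.2.1), x.2.2⟩
      left_inv := fun _ => rfl
      right_inv := fun _ => rfl }
  have := Fintype.ofFinite {x : V // x ∈ (⊤ : Submodule K V) ∧ x ∉ LinearMap.ker B}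
  rw [Nat.card_congr e, Nat.card_sigma]
  have : ∀ e : {x : V // x ∈ (⊤ : Submodule K V) ∧ x ∉ LinearMap.ker B},
      Nat.card {f : V // B e.1 f = 1} = Fintype.card K ^ (finrank K V - 1) := fun e =>
    card_fiber _ (fun h => e.2.2 (LinearMap.mem_ker.2 h))
  simp only [this, Finset.sum_const, Finset.card_univ, smul_eq_mul]
  rw [← Nat.card_eq_fintype_card, card_diff _ _ le_top, finrank_top]

lemma finrank_ker_restrict {K : Type w} {V : Type u} [Field K] [AddCommGroup V] [Module K V]
    (B : LinearMap.BilinForm K V) (hB : B.IsAlt) (C : Submodule K V) :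
    finrank K (LinearMap.ker (B.restrict C)) = finrank K ↥(C ⊓ B.orthogonal C) := by
  have h : (LinearMap.ker (B.restrict C)).map C.subtype = C ⊓ B.orthogonal C := by
    ext x
    constructor
    · rintro ⟨x, hx, rfl⟩
      refine ⟨x.2, fun y hy => ?_⟩
      have h1 : B x y = 0 := LinearMap.congr_fun (LinearMap.mem_ker.1 hx) ⟨y, hy⟩
      change B y x = 0
      exact hB.isRefl _ _ h1
    · rintro ⟨hx, hx2⟩
      refine ⟨⟨x, hx⟩, LinearMap.mem_ker.2 ?_, rfl⟩
      ext y
      have h1 : B y x = 0 := hx2 y y.2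
      exact hB.isRefl _ _ h1
  rw [← h, Submodule.finrank_map_subtype_eq]

/-- the codes with given hull dimension -/
def HullSet {K : Type w} {V : Type u} [Field K] [AddCommGroup V] [Module K V]
    (B : LinearMap.BilinForm K V) (k l : ℕ) : Set (Submodule K V) :=
  {C | finrank K C = 2 * k + l ∧ finrank K ↥(C ⊓ B.orthogonal C) = l}

section hyp
variable {K : Type w} {V : Type u} [Field K] [AddCommGroup V] [Module K V]

lemma hfe (B : LinearMap.BilinForm K V) (hB : B.IsAlt) (e f : V) (hef : B e f = 1)
    : B f e = -1 := by rw [← hB.neg_eq, hef]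

lemma mem_perp (B : LinearMap.BilinForm K V) (hB : B.IsAlt) (e f : V) (hef : B e f = 1)
    (x : V) : x ∈ B.orthogonal (Submodule.span K {e, f}) ↔ B e x = 0 ∧ B f x = 0 := by
  rw [LinearMap.BilinForm.mem_orthogonal_iff]
  constructor
  · intro h
    exact ⟨h e (Submodule.subset_span (by simp)), h f (Submodule.subset_span (by simp))⟩
  · rintro ⟨h1, h2⟩ y hy
    obtain ⟨a, b, rfl⟩ := Submodule.mem_span_pair.1 hy
    simp [h1, h2]

lemma decomp (B : LinearMap.BilinForm K V) (hB : B.IsAlt) (e f : V) (hef : B e f = 1)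
    (x : V) : x - (B x f • e + B e x • f) ∈ B.orthogonal (Submodule.span K {e, f}) := by
  rw [mem_perp B hB e f hef]
  have h1 := hB e
  have h2 := hB f
  have h3 := hfe B hB e f hef
  have h4 := hB.neg_eq x f
  simp [h1, h2, h3, hef, ← h4]

lemma perp_disj (B : LinearMap.BilinForm K V) (hB : B.IsAlt) (e f : V) (hef : B e f = 1)
    : Disjoint (Submodule.span K {e, f}) (B.orthogonal (Submodule.span K {e, f})) := by
  rw [Submodule.disjoint_def]
  intro x hx hx2
  obtain ⟨a, b, rfl⟩ := Submodule.mem_span_pair.1 hx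
  have h := (mem_perp B hB e f hef _).1 hx2
  have h1 := hB e
  have h2 := hB f
  have h3 := hfe B hB e f hef
  simp [h1, h2, h3, hef] at h
  simp [h]

lemma span_finrank (B : LinearMap.BilinForm K V) (hB : B.IsAlt) (e f : V) (hef : B e f = 1)
    : finrank K (Submodule.span K {e, f}) = 2 := by
  have : LinearIndependent K ![e, f] := by
    rw [LinearIndependent.pair_iff]
    intro a b h
    have h1 := congrArg (B e) h
    have h2 := congrArg (B f) h
    have h3 := hfe B hB e f hef
    simp [hB e, hB f, hef, h3] at h1 h2
    exact ⟨h2, h1⟩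
  have h := finrank_span_eq_card this
  rw [Matrix.range_cons_cons_empty] at h
  simpa using h

lemma restrict_nondeg (B : LinearMap.BilinForm K V) (hB : B.IsAlt) (e f : V) (hef : B e f = 1)
    [FiniteDimensional K V] (hN : B.Nondegenerate) :
    (B.restrict (B.orthogonal (Submodule.span K {e, f}))).Nondegenerate := by
  rw [LinearMap.BilinForm.restrict_nondegenerate_iff_isCompl_orthogonal hB.isRefl,
    LinearMap.BilinForm.orthogonal_orthogonal hN hB.isRefl]
  exact ((LinearMap.BilinForm.isCompl_orthogonal_iff_disjoint hB.isRefl).2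
    (perp_disj B hB e f hef)).symm

lemma card_contain (B : LinearMap.BilinForm K V) (hB : B.IsAlt) (e f : V) (hef : B e f = 1)
    [FiniteDimensional K V] (k l : ℕ) :
    Nat.card {C : Submodule K V // C ∈ HullSet B (k+1) l ∧ e ∈ C ∧ f ∈ C} =
    Nat.card (HullSet (B.restrict (B.orthogonal (Submodule.span K {e, f}))) k l) := by
  set W := Submodule.span K {e, f} with hW
  set P := B.orthogonal W with hP
  have hWP : Disjoint W P := perp_disj B hB e f hef
  have heW : e ∈ W := Submodule.subset_span (by simp)
  have hfW : f ∈ W := Submodule.subset_span (by simp)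
  have hcomap : ∀ C' : Submodule K P, (W ⊔ C'.map P.subtype).comap P.subtype = C' := by
    intro C'
    ext x
    simp only [Submodule.mem_comap, Submodule.mem_sup]
    constructor
    · rintro ⟨w, hw, c, hc, h⟩
      obtain ⟨c', hc', rfl⟩ := hc
      have hwP : w ∈ P := by
        have : w = ((x - c' : P) : V) := by
          simp only [Submodule.coe_sub]
          simp only [Submodule.subtype_apply] at h
          rw [← h]; simp
        rw [this]; exact (x - c').2
      have h0 : w = 0 := Submodule.disjoint_def.1 hWP w hw hwP
      rw [h0, zero_add] at h
      have : c' = x := Subtype.ext h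
      exact this ▸ hc'
    · intro hx
      exact ⟨0, W.zero_mem, x, ⟨x, hx, rfl⟩, by simp⟩
  have hrec : ∀ C : Submodule K V, e ∈ C → f ∈ C → W ⊔ (C.comap P.subtype).map P.subtype = C := by
    intro C he hf
    have hWC : W ≤ C := by
      rw [hW, Submodule.span_le]
      rintro x (rfl | rfl) <;> assumption
    rw [Submodule.map_comap_subtype]
    apply le_antisymm
    · exact sup_le hWC inf_le_right
    · intro x hx
      have hd := decomp B hB e f hef x
      have hw : B x f • e + B e x • f ∈ W := W.add_mem (W.smul_mem _ heW) (W.smul_mem _ hfW)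
      refine Submodule.mem_sup.2 ⟨_, hw, _, ⟨hd, C.sub_mem hx (hWC hw)⟩, by abel⟩
  have hfin : ∀ C' : Submodule K P,
      finrank K ↥(W ⊔ C'.map P.subtype) = 2 + finrank K C' := by
    intro C'
    have h := Submodule.finrank_sup_add_finrank_inf_eq W (C'.map P.subtype)
    have hd : W ⊓ C'.map P.subtype = ⊥ :=
      (hWP.mono_right (Submodule.map_subtype_le P C')).eq_bot
    rw [hd, finrank_bot, Submodule.finrank_map_subtype_eq, span_finrank B hB e f hef] at h
    omega
  have hrad : ∀ C' : Submodule K P,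
      (W ⊔ C'.map P.subtype) ⊓ B.orthogonal (W ⊔ C'.map P.subtype) =
        (C' ⊓ (B.restrict P).orthogonal C').map P.subtype := by
    intro C'
    ext x
    constructor
    · rintro ⟨h1, h2⟩
      have h2' := LinearMap.BilinForm.mem_orthogonal_iff.1 h2
      have hxP : x ∈ P := LinearMap.BilinForm.orthogonal_le le_sup_left h2
      refine ⟨⟨x, hxP⟩, ⟨?_, ?_⟩, rfl⟩
      · rw [SetLike.mem_coe, ← hcomap C']
        exact h1
      · intro y hy
        exact h2' y (Submodule.mem_sup_right ⟨y, hy, rfl⟩)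
    · rintro ⟨x, ⟨h1, h2⟩, rfl⟩
      refine ⟨Submodule.mem_sup_right ⟨x, h1, rfl⟩, ?_⟩
      intro y hy
      obtain ⟨w, hw, _, ⟨c, hc, rfl⟩, rfl⟩ := Submodule.mem_sup.1 hy
      have a1 : B w x = 0 := x.2 w hw
      have a2 : B c x = 0 := h2 c hc
      change B (w + c) x = 0
      simp [a1, a2]
  have hmem : ∀ C' : Submodule K P, (W ⊔ C'.map P.subtype) ∈ HullSet B (k+1) l ↔
      C' ∈ HullSet (B.restrict P) k l := by
    intro C'
    simp only [HullSet, Set.mem_ofPred_eq]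
    rw [hfin, hrad, Submodule.finrank_map_subtype_eq]
    constructor <;> rintro ⟨h1, h2⟩ <;> exact ⟨by omega, h2⟩
  symm
  refine Nat.card_eq_of_bijective (fun C' : HullSet (B.restrict P) k l =>
    (⟨W ⊔ C'.1.map P.subtype, (hmem _).2 C'.2, Submodule.mem_sup_left heW,
      Submodule.mem_sup_left hfW⟩ :
      {C : Submodule K V // C ∈ HullSet B (k+1) l ∧ e ∈ C ∧ f ∈ C})) ⟨?_, ?_⟩
  · intro C₁ C₂ h
    have h' := congrArg (fun C => Submodule.comap P.subtype C.1) h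
    simp only [hcomap] at h'
    exact Subtype.ext h'
  · rintro ⟨C, h, he, hf⟩
    have hr := hrec C he hf
    refine ⟨⟨C.comap P.subtype, (hmem _).1 (by rw [hr]; exact h)⟩, Subtype.ext hr⟩

end hyp

lemma step_count {K : Type w} {V : Type u} [Field K] [Fintype K] [AddCommGroup V] [Module K V]
    [Finite V] (B : LinearMap.BilinForm K V) (hB : B.IsAlt) (hN : B.Nondegenerate) (k l M : ℕ)
    (hM : ∀ e f : V, B e f = 1 →
      Nat.card (HullSet (B.restrict (B.orthogonal (Submodule.span K {e, f}))) k l) = M) :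
    Nat.card (HullSet B (k+1) l) *
      ((Fintype.card K ^ (2*(k+1)+l) - Fintype.card K ^ l) * Fintype.card K ^ (2*k+1+l)) =
      (Fintype.card K ^ finrank K V - 1) * Fintype.card K ^ (finrank K V - 1) * M := by
  have : FiniteDimensional K V := Module.Finite.of_finite
  have : Finite (Submodule K V) := Finite.of_injective (fun C => (C : Set V)) SetLike.coe_injective
  let E : (Σ C : HullSet B (k+1) l, {p : C.1 × C.1 // (B.restrict C.1) p.1 p.2 = 1}) ≃
      (Σ p : {p : V × V // B p.1 p.2 = 1},
        {C : Submodule K V // C ∈ HullSet B (k+1) l ∧ p.1.1 ∈ C ∧ p.1.2 ∈ C}) :=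
    { toFun := fun x => ⟨⟨(x.2.1.1, x.2.1.2), x.2.2⟩, ⟨x.1.1, x.1.2, x.2.1.1.2, x.2.1.2.2⟩⟩
      invFun := fun y => ⟨⟨y.2.1, y.2.2.1⟩,
        ⟨(⟨y.1.1.1, y.2.2.2.1⟩, ⟨y.1.1.2, y.2.2.2.2⟩), y.1.2⟩⟩
      left_inv := fun _ => rfl
      right_inv := fun _ => rfl }
  have h := Nat.card_congr E
  have := Fintype.ofFinite (HullSet B (k+1) l)
  have := Fintype.ofFinite {p : V × V // B p.1 p.2 = 1}
  rw [Nat.card_sigma, Nat.card_sigma] at h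
  have h1 : ∀ C : HullSet B (k+1) l,
      Nat.card {p : C.1 × C.1 // (B.restrict C.1) p.1 p.2 = 1} =
      (Fintype.card K ^ (2*(k+1)+l) - Fintype.card K ^ l) * Fintype.card K ^ (2*k+1+l) := by
    intro C
    rw [card_hyp, finrank_ker_restrict B hB, C.2.1, C.2.2]
    congr 2
    omega
  have h2 : ∀ p : {p : V × V // B p.1 p.2 = 1},
      Nat.card {C : Submodule K V // C ∈ HullSet B (k+1) l ∧ p.1.1 ∈ C ∧ p.1.2 ∈ C} = M := by
    intro p
    rw [card_contain B hB _ _ p.2, hM _ _ p.2]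
  simp only [h1, h2, Finset.sum_const, Finset.card_univ, smul_eq_mul] at h
  rw [← Nat.card_eq_fintype_card (α := HullSet B (k+1) l),
    ← Nat.card_eq_fintype_card (α := {p : V × V // B p.1 p.2 = 1}), card_hyp, hN.ker_eq_bot,
    finrank_bot, pow_zero] at h
  exact h

/-- isotropic independent tuples -/
def IsoTup {K : Type w} {V : Type u} [Field K] [AddCommGroup V] [Module K V]
    (B : LinearMap.BilinForm K V) (l : ℕ) : Set (Fin l → V) :=
  {v | LinearIndependent K v ∧ ∀ i j, B (v i) (v j) = 0}

lemma mem_orth_span {K : Type w} {V : Type u} [Field K] [AddCommGroup V] [Module K V]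
    (B : LinearMap.BilinForm K V) (S : Set V) (x : V) :
    x ∈ B.orthogonal (Submodule.span K S) ↔ ∀ y ∈ S, B y x = 0 := by
  constructor
  · intro h y hy
    exact h y (Submodule.subset_span hy)
  · intro h
    have : Submodule.span K S ≤ LinearMap.ker (B.flip x) := by
      rw [Submodule.span_le]
      intro y hy
      exact h y hy
    intro y hy
    exact this hy

lemma isoTup_card {K : Type w} {V : Type u} [Field K] [Fintype K] [AddCommGroup V] [Module K V]
    [Finite V] (B : LinearMap.BilinForm K V) (hB : B.IsAlt) (hN : B.Nondegenerate) (l : ℕ) :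
    Nat.card (IsoTup B l) = ∏ j ∈ Finset.range l,
      (Fintype.card K ^ (finrank K V - j) - Fintype.card K ^ j) := by
  have : FiniteDimensional K V := Module.Finite.of_finite
  induction l with
  | zero =>
    rw [Finset.range_zero, Finset.prod_empty, Nat.card_eq_one_iff_unique]
    refine ⟨inferInstance, ⟨⟨Fin.elim0, linearIndependent_empty_type, fun i => i.elim0⟩⟩⟩
  | succ l ih =>
    have hbij : Nat.card (Σ v : IsoTup B l,
        {x : V // x ∈ B.orthogonal (Submodule.span K (Set.range v.1)) ∧
          x ∉ Submodule.span K (Set.range v.1)}) = Nat.card (IsoTup B (l+1)) := by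
      refine Nat.card_eq_of_bijective (fun y => ⟨Fin.cons y.2.1 y.1.1, ?_, ?_⟩) ⟨?_, ?_⟩
      · exact linearIndependent_finCons.2 ⟨y.1.2.1, y.2.2.2⟩
      · have h := (mem_orth_span B _ _).1 y.2.2.1
        intro i j
        refine Fin.cases ?_ (fun i => ?_) i <;> refine Fin.cases ?_ (fun j => ?_) j
        · simpa using hB _
        · simpa using hB.isRefl _ _ (h _ ⟨j, rfl⟩)
        · simpa using h _ ⟨i, rfl⟩
        · simpa using y.1.2.2 i j
      · rintro ⟨⟨v, hv⟩, ⟨x, hx⟩⟩ ⟨⟨v', hv'⟩, ⟨x', hx'⟩⟩ h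
        have h' : (Fin.cons x v : Fin (l+1) → V) = Fin.cons x' v' := congrArg Subtype.val h
        rw [Fin.cons_inj] at h'
        obtain ⟨rfl, rfl⟩ := h'
        rfl
      · rintro ⟨v, hv, hv2⟩
        have hc : (Fin.cons (v 0) (Fin.tail v) : Fin (l+1) → V) = v := Fin.cons_self_tail v
        have hv' := hv
        rw [← hc] at hv'
        obtain ⟨a1, a2⟩ := linearIndependent_finCons.1 hv'
        refine ⟨⟨⟨Fin.tail v, a1, fun i j => hv2 _ _⟩, ⟨v 0, ?_, a2⟩⟩, Subtype.ext hc⟩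
        rw [mem_orth_span]
        rintro _ ⟨i, rfl⟩
        exact hv2 _ _
    have := Fintype.ofFinite (IsoTup B l)
    rw [← hbij, Nat.card_sigma]
    have h1 : ∀ v : IsoTup B l, Nat.card
        {x : V // x ∈ B.orthogonal (Submodule.span K (Set.range v.1)) ∧
          x ∉ Submodule.span K (Set.range v.1)} =
        Fintype.card K ^ (finrank K V - l) - Fintype.card K ^ l := by
      intro v
      rw [card_diff, LinearMap.BilinForm.finrank_orthogonal hN, finrank_span_eq_card v.2.1,
        Fintype.card_fin]
      rw [Submodule.span_le]
      rintro _ ⟨i, rfl⟩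
      rw [SetLike.mem_coe, mem_orth_span]
      rintro _ ⟨j, rfl⟩
      exact v.2.2 _ _
    simp only [h1, Finset.sum_const, Finset.card_univ, smul_eq_mul]
    rw [← Nat.card_eq_fintype_card (α := IsoTup B l), ih, Finset.prod_range_succ]

lemma base_count {K : Type w} {V : Type u} [Field K] [Fintype K] [AddCommGroup V] [Module K V]
    [Finite V] (B : LinearMap.BilinForm K V) (hB : B.IsAlt) (hN : B.Nondegenerate) (l : ℕ) :
    Nat.card (HullSet B 0 l) *
      ∏ j ∈ Finset.range l, (Fintype.card K ^ l - Fintype.card K ^ j) =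
      ∏ j ∈ Finset.range l, (Fintype.card K ^ (finrank K V - j) - Fintype.card K ^ j) := by
  have : FiniteDimensional K V := Module.Finite.of_finite
  have : Finite (Submodule K V) := Finite.of_injective (fun C => (C : Set V)) SetLike.coe_injective
  rw [← isoTup_card B hB hN]
  have hiso : ∀ C : Submodule K V, C ∈ HullSet B 0 l ↔
      finrank K C = l ∧ ∀ x ∈ C, ∀ y ∈ C, B x y = 0 := by
    intro C
    simp only [HullSet, Set.mem_ofPred_eq, mul_zero, zero_add]
    refine and_congr_right fun h => ?_
    constructor
    · intro h2 x hx y hy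
      have h3 : C ⊓ B.orthogonal C = C :=
        Submodule.eq_of_le_of_finrank_eq inf_le_left (by rw [h2, h])
      have h4 : C ≤ B.orthogonal C := inf_eq_left.1 h3
      exact h4 hy x hx
    · intro h2
      have h4 : C ≤ B.orthogonal C := fun y hy x hx => h2 x hx y hy
      rw [inf_eq_left.2 h4, h]
  have hbij : Nat.card (Σ C : HullSet B 0 l, {s : Fin l → C.1 // LinearIndependent K s}) =
      Nat.card (IsoTup B l) := by
    have hspan : ∀ (C : HullSet B 0 l) (s : Fin l → C.1), LinearIndependent K s →
        Submodule.span K (Set.range fun i => (s i : V)) = C.1 := by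
      intro C s hs
      have hs' : LinearIndependent K (fun i => (s i : V)) :=
        hs.map' C.1.subtype (Submodule.ker_subtype _)
      apply Submodule.eq_of_le_of_finrank_eq
      · rw [Submodule.span_le]
        rintro _ ⟨i, rfl⟩
        exact (s i).2
      · rw [finrank_span_eq_card hs', Fintype.card_fin, ((hiso _).1 C.2).1]
    refine Nat.card_eq_of_bijective (fun y => ⟨fun i => (y.2.1 i : V), ?_, ?_⟩) ⟨?_, ?_⟩
    · exact y.2.2.map' y.1.1.subtype (Submodule.ker_subtype _)
    · intro i j
      exact ((hiso _).1 y.1.2).2 _ (y.2.1 i).2 _ (y.2.1 j).2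
    · rintro ⟨C, s, hs⟩ ⟨C', s', hs'⟩ h
      have h' : (fun i => (s i : V)) = fun i => (s' i : V) := congrArg Subtype.val h
      have hC : C = C' := by
        apply Subtype.ext
        rw [← hspan C s hs, ← hspan C' s' hs', h']
      subst hC
      have : s = s' := by
        funext i
        exact Subtype.ext (congrFun h' i)
      subst this
      rfl
    · rintro ⟨v, hv, hv2⟩
      have hle : Submodule.span K (Set.range v) ≤
          B.orthogonal (Submodule.span K (Set.range v)) := by
        rw [Submodule.span_le]
        rintro _ ⟨i, rfl⟩
        rw [SetLike.mem_coe, mem_orth_span]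
        rintro _ ⟨j, rfl⟩
        exact hv2 _ _
      refine ⟨⟨⟨Submodule.span K (Set.range v), (hiso _).2 ⟨?_, ?_⟩⟩,
        ⟨fun i => ⟨v i, Submodule.subset_span ⟨i, rfl⟩⟩, linearIndependent_span hv⟩⟩, rfl⟩
      · rw [finrank_span_eq_card hv, Fintype.card_fin]
      · intro x hx y hy
        exact hle hy x hx
  have := Fintype.ofFinite (HullSet B 0 l)
  rw [← hbij, Nat.card_sigma]
  have h1 : ∀ C : HullSet B 0 l, Nat.card {s : Fin l → C.1 // LinearIndependent K s} =
      ∏ j ∈ Finset.range l, (Fintype.card K ^ l - Fintype.card K ^ j) := by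
    intro C
    have hf := ((hiso _).1 C.2).1
    rw [card_linearIndependent hf.ge, hf, Finset.prod_range]
  simp only [h1, Finset.sum_const, Finset.card_univ, smul_eq_mul]
  rw [← Nat.card_eq_fintype_card (α := HullSet B 0 l)]

lemma main_count {K : Type w} [Field K] [Fintype K] (l s k : ℕ) :
    ∀ {V : Type u} [AddCommGroup V] [Module K V]
    [Finite V] (B : LinearMap.BilinForm K V) (_ : B.IsAlt) (_ : B.Nondegenerate),
    finrank K V = 2 * (k + l + s) →
    (Nat.card (HullSet B k l) : ℝ) = cform (Fintype.card K : ℝ) k l s := by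
  have hq : 1 < Fintype.card K := Fintype.one_lt_card
  have hQ : (1 : ℝ) < Fintype.card K := by exact_mod_cast hq
  induction k with
  | zero =>
    intro V _ _ _ B hB hN hd
    have h := base_count B hB hN l
    have hc := cform_base hQ l s
    have hpos : (∏ j ∈ Finset.range l, ((Fintype.card K : ℝ) ^ l - (Fintype.card K : ℝ) ^ j)) ≠ 0 := by
      rw [Finset.prod_ne_zero_iff]
      intro j hj
      have : (Fintype.card K : ℝ) ^ j < (Fintype.card K : ℝ) ^ l :=
        pow_lt_pow_right₀ hQ (by simpa using hj)
      linarith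
    refine mul_right_cancel₀ hpos ?_
    rw [hc]
    have h' := congrArg (fun m : ℕ => (m : ℝ)) h
    simp only [Nat.cast_mul, Nat.cast_prod] at h'
    rw [hd] at h'
    convert h' using 2
    · refine Finset.prod_congr rfl fun j hj => ?_
      have : j < l := by simpa using hj
      rw [Nat.cast_sub (Nat.pow_le_pow_right hq.le this.le)]
      push_cast; rfl
    · rename_i j hj
      have : j < l := by simpa using hj
      rw [Nat.cast_sub (Nat.pow_le_pow_right hq.le (by omega))]
      push_cast
      simp
  | succ k ih =>
    intro V _ _ _ B hB hN hd
    have : FiniteDimensional K V := Module.Finite.of_finite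
    by_cases hex : ∃ e f : V, B e f = 1
    swap
    · exfalso
      have hnt : Nontrivial V := by
        apply Module.nontrivial_of_finrank_pos (R := K); omega
      obtain ⟨e, he⟩ := exists_ne (0 : V)
      apply he
      apply hN.1
      intro f
      by_contra hne
      exact hex ⟨e, (B e f)⁻¹ • f, by simp [hne]⟩
    have key : ∀ e f : V, B e f = 1 →
        (Nat.card (HullSet (B.restrict (B.orthogonal (Submodule.span K {e, f}))) k l) : ℝ) =
          cform (Fintype.card K : ℝ) k l s := by
      intro e f hef
      apply ih
      · intro x
        exact hB x
      · exact restrict_nondeg B hB e f hef hN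
      · rw [LinearMap.BilinForm.finrank_orthogonal hN, span_finrank B hB e f hef, hd]
        omega
    obtain ⟨e₀, f₀, h₀⟩ := hex
    have h := step_count B hB hN k l
      (Nat.card (HullSet (B.restrict (B.orthogonal (Submodule.span K {e₀, f₀}))) k l))
      (fun e f hef => by
        have := (key e f hef).trans (key e₀ f₀ h₀).symm
        exact_mod_cast this)
    have h' := congrArg (fun m : ℕ => (m : ℝ)) h
    simp only [Nat.cast_mul] at h'
    rw [key e₀ f₀ h₀, Nat.cast_sub (Nat.pow_le_pow_right hq.le (by omega)),
      Nat.cast_sub (Nat.one_le_pow _ _ (by omega)), hd] at h'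
    push_cast at h'
    have hc := cform_step hQ k l s
    have hpos : ((Fintype.card K : ℝ)^(2*(k+1)+l) - (Fintype.card K : ℝ)^l) *
        (Fintype.card K : ℝ)^(2*k+1+l) ≠ 0 := by
      have : (Fintype.card K : ℝ) ^ l < (Fintype.card K : ℝ) ^ (2*(k+1)+l) :=
        pow_lt_pow_right₀ hQ (by omega)
      have h1 : (Fintype.card K : ℝ)^(2*(k+1)+l) - (Fintype.card K : ℝ)^l ≠ 0 := by linarith
      have h2 : (Fintype.card K : ℝ)^(2*k+1+l) ≠ 0 := by positivity
      exact mul_ne_zero h1 h2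
    refine mul_right_cancel₀ hpos ?_
    rw [hc, h']
    congr 3
    omega

/-- the symplectic form as a bilinear form -/
def sympForm (K : Type w) [Field K] (n : ℕ) : LinearMap.BilinForm K (Fin (2 * n) → K) :=
  LinearMap.mk₂ K (sympInner n)
    (fun x y z => by
      simp only [sympInner, Pi.add_apply, ← Finset.sum_add_distrib]
      exact Finset.sum_congr rfl fun i _ => by ring)
    (fun c x y => by
      simp only [sympInner, Pi.smul_apply, smul_eq_mul, Finset.mul_sum]
      exact Finset.sum_congr rfl fun i _ => by ring)
    (fun x y z => by
      simp only [sympInner, Pi.add_apply, ← Finset.sum_add_distrib]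
      exact Finset.sum_congr rfl fun i _ => by ring)
    (fun c x y => by
      simp only [sympInner, Pi.smul_apply, smul_eq_mul, Finset.mul_sum]
      exact Finset.sum_congr rfl fun i _ => by ring)

lemma sympForm_alt (K : Type w) [Field K] (n : ℕ) : (sympForm K n).IsAlt := by
  intro x
  change sympInner n x x = 0
  exact Finset.sum_eq_zero fun i _ => by ring

lemma sympForm_nondeg (K : Type w) [Field K] (n : ℕ) : (sympForm K n).Nondegenerate := by
  have key : ∀ x : Fin (2 * n) → K, (∀ y, sympInner n x y = 0) → x = 0 := by
    intro x h
    funext j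
    by_cases hj : j.1 < n
    · have h1 := h (Pi.single ⟨n + j.1, by omega⟩ 1)
      rw [sympInner, Finset.sum_eq_single ⟨j.1, hj⟩] at h1
      · simpa [Pi.single_apply, Fin.ext_iff, show n ≠ 0 by omega] using h1
      · intro b _ hb
        have : b.1 ≠ j.1 := fun h => hb (Fin.ext h)
        simp [Pi.single_apply, Fin.ext_iff, this, show b.1 ≠ n + j.1 by omega]
      · simp
    · have hj2 := j.2
      have h1 := h (Pi.single ⟨j.1 - n, by omega⟩ 1)
      rw [sympInner, Finset.sum_eq_single ⟨j.1 - n, by omega⟩] at h1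
      · have e : (⟨n + (j.1 - n), by omega⟩ : Fin (2 * n)) = j := Fin.ext (by simp; omega)
        simpa [Pi.single_apply, Fin.ext_iff, e, show j.1 ≠ j.1 - n by omega] using h1
      · intro b _ hb
        have : b.1 ≠ j.1 - n := fun h => hb (Fin.ext h)
        simp [Pi.single_apply, Fin.ext_iff, this, show n + b.1 ≠ j.1 - n by omega]
      · simp
  refine ⟨fun x h => key x h, fun x h => key x fun y => ?_⟩
  exact (sympForm_alt K n).isRefl _ _ (h y)

end linalg

theorem symplectic_hull_asymptotics
    (q : ℕ) (hq : IsPrimePow q)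
    {K : Type*} [Field K] [Fintype K] (hK : Fintype.card K = q)
    (ℓ : ℕ) :
    ∀ ε : ℝ, 0 < ε → ∃ N : ℕ, ∀ n k₀ : ℕ,
      N ≤ k₀ → N ≤ n - k₀ → 2 * k₀ + ℓ ≤ 2 * n →
      |(Nat.card {C : Submodule K (Fin (2 * n) → K) //
            Module.finrank K C = 2 * k₀ + ℓ ∧
              Module.finrank K ↥(C ⊓ sympDual n C) = ℓ} : ℝ) /
          gaussBinom (q : ℝ) (2 * n) (2 * k₀ + ℓ) -
        (q : ℝ) ^ ℓ * ginfty (q : ℝ) / (hpoly (q : ℝ) ℓ * ginfty ((q : ℝ) ^ 2))| < ε := by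
  intro ε hε
  have hQ : (1 : ℝ) < (q : ℝ) := by exact_mod_cast hq.one_lt
  obtain ⟨⟨N1, N2⟩, hN⟩ := Filter.eventually_atTop.1
    ((Metric.tendsto_nhds.1 (ratio_tendsto hQ ℓ)) ε hε)
  refine ⟨N1 + N2 + ℓ + 1, fun n k₀ h1 h2 _ => ?_⟩
  obtain ⟨s, rfl⟩ : ∃ s, n = k₀ + ℓ + s := ⟨n - k₀ - ℓ, by omega⟩
  have h3 := hN (k₀, s) ⟨by simp; omega, by simp; omega⟩
  rw [Real.dist_eq] at h3
  have hc : (Nat.card {C : Submodule K (Fin (2 * (k₀ + ℓ + s)) → K) //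
            Module.finrank K C = 2 * k₀ + ℓ ∧
              Module.finrank K ↥(C ⊓ sympDual (k₀ + ℓ + s) C) = ℓ} : ℝ) = cform (q : ℝ) k₀ ℓ s := by
    subst hK
    exact main_count ℓ s k₀ (sympForm K (k₀ + ℓ + s)) (sympForm_alt K _) (sympForm_nondeg K _)
      (by simp)
  rw [hc]
  exact h3
end
end
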